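/- Two alternating n×n matrices over a field F are B-congruent if and only if they are B-equivalent. -/

import Mathlib

open Matrix

variable {F : Type*} [Field F] {n : ℕ}

/-- Membership in `B`: invertible upper triangular matrices. -/
def InB (h : Matrix (Fin n) (Fin n) F) : Prop :=
  IsUnit h.det ∧ ∀ i j : Fin n, j < i → h i j = 0

/-- An alternating matrix: `Xᵀ = -X` and all diagonal entries are 0. -/
def IsAlternating (X : Matrix (Fin n) (Fin n) F) : Prop :=
  Xᵀ = -X ∧ ∀ i, X i i = 0

lemma inB_iff {h : Matrix (Fin n) (Fin n) F} :
    InB h ↔ (∀ i, h i i ≠ 0) ∧ ∀ i j : Fin n, j < i → h i j = 0 := by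
  refine and_congr_left fun ht => ?_
  have ht' : h.BlockTriangular id := fun i j hij => ht i j hij
  rw [det_of_isUpperTriangular ht', isUnit_iff_ne_zero, Finset.prod_ne_zero_iff]
  simp

lemma InB.one : InB (1 : Matrix (Fin n) (Fin n) F) :=
  inB_iff.2 ⟨by simp, fun _ _ hij => one_apply_ne hij.ne'⟩

lemma InB.mul {h k : Matrix (Fin n) (Fin n) F} (hh : InB h) (hk : InB k) : InB (h * k) := by
  refine ⟨by rw [det_mul]; exact hh.1.mul hk.1, ?_⟩
  have h1 : h.BlockTriangular id := fun i j hij => hh.2 i j hij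
  have h2 : k.BlockTriangular id := fun i j hij => hk.2 i j hij
  exact fun i j hij => h1.mul h2 hij

lemma InB.inv {h : Matrix (Fin n) (Fin n) F} (hh : InB h) : InB h⁻¹ := by
  refine ⟨isUnit_nonsing_inv_det h hh.1, ?_⟩
  have h1 : h.BlockTriangular id := fun i j hij => hh.2 i j hij
  have := invertibleOfIsUnitDet h hh.1
  exact fun i j hij => blockTriangular_inv_of_blockTriangular h1 hij

/-- Congruence by an element of `B` whose rows outside `S` are those of the identity. -/
def BCongruentOn (S : Finset (Fin n)) (X Y : Matrix (Fin n) (Fin n) F) : Prop :=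
  ∃ h : Matrix (Fin n) (Fin n) F, InB h ∧
    (∀ i ∉ S, ∀ j, h i j = (1 : Matrix (Fin n) (Fin n) F) i j) ∧ Y = hᵀ * X * h

/-- Equivalence under the group `B`. -/
def BEquivalent (X Y : Matrix (Fin n) (Fin n) F) : Prop :=
  ∃ h k : Matrix (Fin n) (Fin n) F, InB h ∧ InB k ∧ Y = hᵀ * X * k

lemma BEquivalent.trans {X Y Z : Matrix (Fin n) (Fin n) F} (hXY : BEquivalent X Y)
    (hYZ : BEquivalent Y Z) : BEquivalent X Z := by
  obtain ⟨h, k, hh, hk, rfl⟩ := hXY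
  obtain ⟨h', k', hh', hk', rfl⟩ := hYZ
  exact ⟨h * h', k * k', hh.mul hh', hk.mul hk', by simp only [transpose_mul, Matrix.mul_assoc]⟩

namespace BCongruentOn

variable {S T : Finset (Fin n)} {X Y Z : Matrix (Fin n) (Fin n) F}

lemma bEquivalent (hXY : BCongruentOn S X Y) : BEquivalent X Y := by
  obtain ⟨h, hh, -, e⟩ := hXY
  exact ⟨h, h, hh, hh, e⟩

lemma mono (hST : S ⊆ T) (hXY : BCongruentOn S X Y) : BCongruentOn T X Y := by
  obtain ⟨h, hh, hr, e⟩ := hXY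
  exact ⟨h, hh, fun i hi => hr i fun hS => hi (hST hS), e⟩

lemma trans (hXY : BCongruentOn S X Y) (hYZ : BCongruentOn S Y Z) : BCongruentOn S X Z := by
  obtain ⟨h, hh, hr, rfl⟩ := hXY
  obtain ⟨k, hk, kr, rfl⟩ := hYZ
  refine ⟨h * k, hh.mul hk, fun i hi j => ?_, by simp only [transpose_mul, Matrix.mul_assoc]⟩
  rw [mul_apply, ← kr i hi j]
  simp [hr i hi, one_apply]

lemma symm (hXY : BCongruentOn S X Y) : BCongruentOn S Y X := by
  obtain ⟨h, hh, hr, rfl⟩ := hXY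
  refine ⟨h⁻¹, hh.inv, fun i hi j => ?_, ?_⟩
  · rw [← mul_nonsing_inv h hh.1, mul_apply]
    simp [hr i hi, one_apply]
  · have e : (h⁻¹)ᵀ * hᵀ = 1 := by rw [← transpose_mul, mul_nonsing_inv h hh.1, transpose_one]
    calc X = ((h⁻¹)ᵀ * hᵀ) * X * (h * h⁻¹) := by rw [e, mul_nonsing_inv h hh.1]; simp
      _ = _ := by simp only [Matrix.mul_assoc]

end BCongruentOn

lemma IsAlternating.apply_swap {X : Matrix (Fin n) (Fin n) F} (hX : IsAlternating X)
    (i j : Fin n) : X i j = -X j i := congrFun (congrFun hX.1 j) i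

lemma IsAlternating.sub {X Y : Matrix (Fin n) (Fin n) F} (hX : IsAlternating X)
    (hY : IsAlternating Y) : IsAlternating (X - Y) :=
  ⟨by rw [transpose_sub, hX.1, hY.1]; abel, fun i => by simp [hX.2, hY.2]⟩

/-- The elementary row and column operation at the pivot `(m, j)` which splits off the
hyperbolic plane spanned by the `m`-th and `j`-th basis vectors. -/
lemma exists_bCongruentOn_pivot {S : Finset (Fin n)} {X : Matrix (Fin n) (Fin n) F}
    (hX : IsAlternating X) (hS : ∀ a ∉ S, ∀ b, X a b = 0) {m j : Fin n} (hm : m ∈ S) (hj : j ∈ S)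
    (hmin : ∀ i ∈ S, m ≤ i) (hmj : X m j ≠ 0) (hfst : ∀ i < j, X m i = 0) :
    ∃ X', BCongruentOn S X X' ∧ IsAlternating X' ∧ (∀ a ∉ S, ∀ b, X' a b = 0) ∧
      (∀ i, X' m i = if i = j then 1 else 0) ∧ ∀ i, X' j i = if i = m then -1 else 0 := by
  have hne : m ≠ j := by rintro rfl; exact hmj (hX.2 m)
  set α : Fin n → F := fun i => if i = j then (X m j)⁻¹ - 1 else -(X m i / X m j) with hα
  set β : Fin n → F := fun i => if i = m then 0 else X j i / X m j with hβ
  set c : Matrix (Fin n) (Fin n) F := of fun q i =>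
    (1 : Matrix (Fin n) (Fin n) F) q i + (if q = j then α i else 0) + (if q = m then β i else 0)
    with hc
  have hS' : ∀ a ∉ S, ∀ b, X b a = 0 := fun a ha b => by rw [hX.apply_swap, hS a ha, neg_zero]
  have hZ : ∀ p i, (X * c) p i = X p i + X p j * α i + X p m * β i := fun p i => by
    simp [mul_apply, hc, mul_add, Finset.sum_add_distrib, one_apply]
  have hW : ∀ p i, (cᵀ * X * c) p i =
      (X * c) p i + α p * (X * c) j i + β p * (X * c) m i := fun p i => by
    rw [Matrix.mul_assoc, mul_apply]
    simp [hc, add_mul, Finset.sum_add_distrib, one_apply]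
  have hαm : α m = 0 := by simp [hα, hne, hX.2]
  have hβm : β m = 0 := by simp [hβ]
  have hβj : β j = 0 := by simp [hβ, hX.2]
  have hαS : ∀ a ∉ S, α a = 0 := fun a ha => by
    have : a ≠ j := by rintro rfl; exact ha hj
    simp [hα, this, hS' a ha]
  have hβS : ∀ a ∉ S, β a = 0 := fun a ha => by simp [hβ, hS' a ha]
  have hjm := hX.apply_swap j m
  have hZm : ∀ i, (X * c) m i = if i = j then 1 else 0 := fun i => by
    rw [hZ, hX.2 m]
    by_cases hi : i = j
    · subst hi; simp [hα]; field_simp; ring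
    · simp [hα, hi]; field_simp; ring
  have hZj : ∀ i, (X * c) j i = if i = m then -X m j else 0 := fun i => by
    rw [hZ, hX.2 j, hjm]
    by_cases hi : i = m
    · subst hi; simp [hβ, hjm]
    · simp [hβ, hi]; field_simp; ring
  refine ⟨cᵀ * X * c, ⟨c, inB_iff.2 ⟨fun i => ?_, fun i k hki => ?_⟩, fun i hi k => ?_, rfl⟩,
    ⟨?_, fun i => ?_⟩, fun a ha b => ?_, fun i => ?_, fun i => ?_⟩
  · by_cases h1 : i = j
    · subst h1; simp [hc, hα, hne.symm, hmj]
    · by_cases h2 : i = m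
      · subst h2; simp [hc, h1, hβm]
      · simp [hc, h1, h2]
  · have e1 : i = j → α k = 0 := by
      rintro rfl
      simp [hα, hki.ne, hfst k hki]
    have e2 : i = m → β k = 0 := by
      rintro rfl
      exact hβS k fun hk => (hmin k hk).not_gt hki
    simp only [hc, of_apply, one_apply_ne hki.ne', zero_add]
    split_ifs with h1 h2 h2 <;> simp_all
  · have h1 : i ≠ j := by rintro rfl; exact hi hj
    have h2 : i ≠ m := by rintro rfl; exact hi hm
    simp [hc, h1, h2]
  · simp only [transpose_mul, transpose_transpose, hX.1, Matrix.mul_assoc]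
    simp
  · rw [hW, hZ, hZ, hZ, hX.2, hX.2, hX.2, hX.apply_swap i j, hX.apply_swap i m, hjm]
    ring
  · rw [hW, hZ, hαS a ha, hβS a ha, hS a ha, hS a ha, hS a ha]
    ring
  · rw [hW, hαm, hβm, hZm]; ring
  · rw [hW, hβj, hZj]
    by_cases hi : i = m
    · simp [hi, hα]; field_simp; ring
    · simp [hi]

/-- The entries of the row of `hᵀ * X * k` indexed by the least index `m` of the support of `X`. -/
lemma transpose_mul_mul_apply_min {S : Finset (Fin n)} {X h : Matrix (Fin n) (Fin n) F}
    (k : Matrix (Fin n) (Fin n) F) (hS : ∀ a ∉ S, ∀ b, X a b = 0) (hh : InB h) {m : Fin n}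
    (hmin : ∀ i ∈ S, m ≤ i) (b : Fin n) :
    (hᵀ * X * k) m b = h m m * ∑ q, X m q * k q b := by
  rw [Matrix.mul_assoc, mul_apply, Finset.sum_eq_single m]
  · rw [transpose_apply, mul_apply]
  · intro p _ hp
    by_cases hpS : p ∈ S
    · rw [transpose_apply, hh.2 p m (lt_of_le_of_ne (hmin p hpS) hp.symm), zero_mul]
    · simp [mul_apply, hS p hpS]
  · simp

/-- The hyperbolic plane on the indices `m` and `j`. -/
def hyperbolicPlane (F : Type*) [Field F] {n : ℕ} (m j : Fin n) : Matrix (Fin n) (Fin n) F := single m j 1 - single j m 1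

lemma isAlternating_hyperbolicPlane {m j : Fin n} (hmj : m ≠ j) :
    IsAlternating (hyperbolicPlane F m j) := by
  refine ⟨by simp [hyperbolicPlane], fun i => ?_⟩
  simp [hyperbolicPlane, single_apply]
  grind

lemma transpose_mul_hyperbolicPlane_mul_apply (m j : Fin n) (h k : Matrix (Fin n) (Fin n) F)
    (a b : Fin n) :
    (hᵀ * hyperbolicPlane F m j * k) a b = h m a * k j b - h j a * k m b := by
  simp [hyperbolicPlane, Matrix.mul_sub, mul_apply, single_apply, ite_and, sub_mul]

/-- Matrices supported on `S` are `B`-equivalent as soon as they are related on `S`. -/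
lemma bEquivalent_of_apply_eq {S : Finset (Fin n)} {X Y h k : Matrix (Fin n) (Fin n) F}
    (hX : ∀ a ∉ S, ∀ b, X a b = 0) (hX' : ∀ b ∉ S, ∀ a, X a b = 0)
    (hY : ∀ a ∉ S, ∀ b, Y a b = 0) (hY' : ∀ b ∉ S, ∀ a, Y a b = 0)
    (hh : InB h) (hk : InB k) (e : ∀ a ∈ S, ∀ b ∈ S, Y a b = (hᵀ * X * k) a b) :
    BEquivalent X Y := by
  have key : ∀ g : Matrix (Fin n) (Fin n) F, InB g → InB (of fun i j : Fin n =>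
      if i ∈ S ∧ j ∈ S then g i j else (1 : Matrix (Fin n) (Fin n) F) i j) := fun g hg => by
    rw [inB_iff] at hg ⊢
    refine ⟨fun i => ?_, fun i j hij => ?_⟩
    · rw [of_apply]
      split_ifs
      exacts [hg.1 i, by simp]
    · rw [of_apply]
      split_ifs
      exacts [hg.2 i j hij, one_apply_ne hij.ne']
  refine ⟨_, _, key h hh, key k hk, ?_⟩
  ext a b
  have expand : ∀ u v : Matrix (Fin n) (Fin n) F,
      (uᵀ * X * v) a b = ∑ p, ∑ q, u p a * X p q * v q b := fun u v => by
    rw [Matrix.mul_assoc]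
    simp only [mul_apply, transpose_apply, Finset.mul_sum, mul_assoc]
  rw [expand]
  by_cases ha : a ∈ S
  · by_cases hb : b ∈ S
    · rw [e a ha b hb, expand]
      refine Finset.sum_congr rfl fun p _ => Finset.sum_congr rfl fun q _ => ?_
      by_cases hp : p ∈ S
      · by_cases hq : q ∈ S
        · simp [ha, hb, hp, hq]
        · simp [hX' q hq]
      · simp [hX p hp]
    · rw [hY' b hb]
      refine (Finset.sum_eq_zero fun p _ => Finset.sum_eq_zero fun q _ => ?_).symm
      by_cases hq : q = b
      · simp [hq, hX' b hb]
      · simp [hb, one_apply_ne hq]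
  · rw [hY a ha]
    refine (Finset.sum_eq_zero fun p _ => Finset.sum_eq_zero fun q _ => ?_).symm
    by_cases hp : p = a
    · simp [hp, hX a ha]
    · simp [ha, one_apply_ne hp]

lemma sub_hyperbolicPlane_apply_eq_zero {S : Finset (Fin n)} {X : Matrix (Fin n) (Fin n) F}
    {m j : Fin n} (hmj : m ≠ j) (hS : ∀ a ∉ S, ∀ b, X a b = 0)
    (hm : ∀ i, X m i = if i = j then 1 else 0) (hj : ∀ i, X j i = if i = m then -1 else 0)
    (a : Fin n) (ha : a ∉ (S.erase m).erase j) (b : Fin n) :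
    (X - hyperbolicPlane F m j) a b = 0 := by
  simp only [Matrix.sub_apply, hyperbolicPlane, single_apply]
  by_cases h1 : a = j
  · subst h1; rw [hj]; grind
  · by_cases h2 : a = m
    · subst h2; rw [hm]; grind
    · rw [hS a (by grind)]; grind

lemma BEquivalent.bCongruentOn (S : Finset (Fin n)) : ∀ {X Y : Matrix (Fin n) (Fin n) F},
    IsAlternating X → IsAlternating Y → (∀ a ∉ S, ∀ b, X a b = 0) → (∀ a ∉ S, ∀ b, Y a b = 0) →
    BEquivalent X Y → BCongruentOn S X Y := by
  induction S using Finset.strongInduction with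
  | H S ih =>
  intro X Y hX hY hXS hYS hXY
  rcases S.eq_empty_or_nonempty with rfl | hne
  · refine ⟨1, InB.one, fun _ _ _ => rfl, ?_⟩
    ext a b
    simp [hXS a, hYS a]
  obtain ⟨m, hm, hmin⟩ : ∃ m ∈ S, ∀ i ∈ S, m ≤ i :=
    ⟨S.min' hne, S.min'_mem hne, fun i hi => S.min'_le i hi⟩
  by_cases hrow : ∀ i, X m i = 0
  · have hYm : ∀ i, Y m i = 0 := fun i => by
      obtain ⟨h, k, hh, -, rfl⟩ := hXY
      rw [transpose_mul_mul_apply_min k hXS hh hmin]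
      simp [hrow]
    refine (ih _ (Finset.erase_ssubset hm) hX hY ?_ ?_ hXY).mono (Finset.erase_subset _ _)
    · intro a ha b
      by_cases h : a = m
      exacts [h ▸ hrow b, hXS a (by grind) b]
    · intro a ha b
      by_cases h : a = m
      exacts [h ▸ hYm b, hYS a (by grind) b]
  push Not at hrow
  obtain ⟨j, hmj, hfst⟩ : ∃ j, X m j ≠ 0 ∧ ∀ i < j, X m i = 0 := by
    obtain ⟨j, hj, hjm⟩ := WellFounded.has_min (wellFounded_lt (α := Fin n)) {i | X m i ≠ 0} hrow
    exact ⟨j, hj, fun i hi => by_contra fun h => hjm i h hi⟩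
  have hmne : m ≠ j := by rintro rfl; exact hmj (hX.2 m)
  have hj : j ∈ S := by
    by_contra h
    exact hmj (by rw [hX.apply_swap, hXS j h, neg_zero])
  obtain ⟨X', hXX', hX', hXS', hXm, hXj⟩ := exists_bCongruentOn_pivot hX hXS hm hj hmin hmj hfst
  have hX'Y : BEquivalent X' Y := hXX'.symm.bEquivalent.trans hXY
  have hrowk : ∀ {h k Z : Matrix (Fin n) (Fin n) F}, InB h → Z = hᵀ * X' * k →
      ∀ i, Z m i = h m m * k j i := by
    rintro h k _ hh rfl i
    rw [transpose_mul_mul_apply_min k hXS' hh hmin]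
    simp [hXm]
  obtain ⟨hYmj, hYfst⟩ : Y m j ≠ 0 ∧ ∀ i < j, Y m i = 0 := by
    obtain ⟨h, k, hh, hk, e⟩ := hX'Y
    have := hrowk hh e
    refine ⟨?_, fun i hi => ?_⟩
    · rw [this]
      exact mul_ne_zero ((inB_iff.1 hh).1 m) ((inB_iff.1 hk).1 j)
    · rw [this, hk.2 j i hi, mul_zero]
  obtain ⟨Y', hYY', hY', hYS', hYm, hYj⟩ := exists_bCongruentOn_pivot hY hYS hm hj hmin hYmj hYfst
  obtain ⟨h, k, hh, hk, e⟩ := hX'Y.trans hYY'.bEquivalent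
  have hkj : ∀ i ≠ j, k j i = 0 := fun i hi => by
    have := hrowk hh e i
    rw [hYm, if_neg hi] at this
    exact (mul_eq_zero.1 this.symm).resolve_left ((inB_iff.1 hh).1 m)
  have e' : Y' = kᵀ * X' * h := by
    rw [← neg_neg Y', ← hY'.1, e]
    simp [hX'.1, Matrix.mul_assoc]
  have hhj : ∀ i ≠ j, h j i = 0 := fun i hi => by
    have := hrowk hk e' i
    rw [hYm, if_neg hi] at this
    exact (mul_eq_zero.1 this.symm).resolve_left ((inB_iff.1 hk).1 m)
  set D : Matrix (Fin n) (Fin n) F := hyperbolicPlane F m j with hD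
  have hDalt : IsAlternating D := isAlternating_hyperbolicPlane hmne
  set T := (S.erase m).erase j with hT
  have hTS : T ⊆ S := (Finset.erase_subset _ _).trans (Finset.erase_subset _ _)
  have hmT : m ∉ T := by grind
  have hjT : j ∉ T := by grind
  have hXT := sub_hyperbolicPlane_apply_eq_zero hmne hXS' hXm hXj
  have hYT := sub_hyperbolicPlane_apply_eq_zero hmne hYS' hYm hYj
  have hXD := hX'.sub hDalt
  have hYD := hY'.sub hDalt
  have hDT : ∀ a ∈ T, ∀ b, D a b = 0 := fun a ha b => by
    simp only [hD, hyperbolicPlane, Matrix.sub_apply, single_apply]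
    grind
  have hEq : BEquivalent (X' - D) (Y' - D) := by
    refine bEquivalent_of_apply_eq hXT (fun b hb a => ?_) hYT (fun b hb a => ?_) hh hk ?_
    · rw [hXD.apply_swap, hXT b hb, neg_zero]
    · rw [hYD.apply_swap, hYT b hb, neg_zero]
    · intro a ha b hb
      rw [Matrix.mul_sub, Matrix.sub_mul, ← e, Matrix.sub_apply, Matrix.sub_apply, hDT a ha,
        transpose_mul_hyperbolicPlane_mul_apply, hkj b (by grind), hhj a (by grind)]
      ring
  obtain ⟨g, hg, hgT, eg⟩ := ih T (Finset.ssubset_iff_of_subset hTS |>.2 ⟨m, hm, hmT⟩)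
    hXD hYD hXT hYT hEq
  have hgD : gᵀ * D * g = D := by
    ext a b
    rw [transpose_mul_hyperbolicPlane_mul_apply, hgT m hmT, hgT m hmT, hgT j hjT, hgT j hjT]
    simp only [hD, hyperbolicPlane, Matrix.sub_apply, single_apply, one_apply]
    grind
  have hX'Y' : BCongruentOn S X' Y' := by
    refine BCongruentOn.mono hTS ⟨g, hg, hgT, ?_⟩
    rw [Matrix.mul_sub, Matrix.sub_mul, hgD] at eg
    exact sub_left_injective eg
  exact (hXX'.trans hX'Y').trans hYY'.symm

/-- Two alternating matrices are `B`-congruent iff they are `B`-equivalent. -/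
theorem alt_B_congruent_iff_B_equivalent (hn : 2 ≤ n)
    (X Y : Matrix (Fin n) (Fin n) F) (hX : IsAlternating X) (hY : IsAlternating Y) :
    (∃ h : Matrix (Fin n) (Fin n) F, InB h ∧ Y = hᵀ * X * h) ↔
      (∃ h k : Matrix (Fin n) (Fin n) F, InB h ∧ InB k ∧ Y = hᵀ * X * k) := by
  constructor
  · rintro ⟨h, hh, e⟩
    exact ⟨h, h, hh, hh, e⟩
  · intro hXY
    obtain ⟨h, hh, -, e⟩ := BEquivalent.bCongruentOn Finset.univ hX hY (by simp) (by simp) hXY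
    exact ⟨h, hh, e⟩
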